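/- Let V be the real vector space of finitely supported sequences m : ℕ → ℝ³, and for k ∈ ℕ, l ∈ {1,2,3} let f^{k,l} : V → V be defined by (f^{k,l}(m))_i = (m_{k+i} + m_{|k−i|}) × e_l. Then for all p, q ∈ ℕ, with the bracket [A,B] := B∘A − A∘B, one has [f^{p,3}, f^{q,1}] = f^{|p−q|,2} + f^{p+q,2}. -/

import Mathlib

/-- The standard basis vectors `e_1, e_2, e_3` of `ℝ³` (indexed by `Fin 3`). -/
noncomputable def stdBasis (l : Fin 3) : Fin 3 → ℝ := Pi.single l 1

/-- The control vector field `f^{k,l}` on the space `V = ℕ →₀ ℝ³` of finitely supported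
sequences, given componentwise by `(f^{k,l}(m))_i = (m_{k+i} + m_{|k−i|}) × e_l`. -/
noncomputable def controlField (k : ℕ) (l : Fin 3) :
    (ℕ →₀ (Fin 3 → ℝ)) →ₗ[ℝ] (ℕ →₀ (Fin 3 → ℝ)) where
  toFun m := Finsupp.onFinset (Finset.range (m.support.sup id + k + 1))
    (fun i => crossProduct (m (k + i) + m (Nat.dist k i)) (stdBasis l))
    (fun i hi => by
      have hne : m (k + i) ≠ 0 ∨ m (Nat.dist k i) ≠ 0 := by
        by_contra hc
        push_neg at hc
        exact hi (by simp [hc.1, hc.2])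
      have hsup : ∀ n, m n ≠ 0 → n ≤ m.support.sup id := fun n hn =>
        Finset.le_sup (f := id) (Finsupp.mem_support_iff.mpr hn)
      rw [Finset.mem_range]
      rcases hne with h | h
      · have := hsup _ h
        omega
      · have h1 := hsup _ h
        have h2 : i ≤ k + Nat.dist k i := by
          rcases Nat.le_total k i with hki | hki
          · rw [Nat.dist_eq_sub_of_le hki]
            omega
          · omega
        omega)
  map_add' m m' := Finsupp.ext fun i => by
    simp only [Finsupp.onFinset_apply, Finsupp.add_apply]
    rw [show m (k + i) + m' (k + i) + (m (Nat.dist k i) + m' (Nat.dist k i))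
        = m (k + i) + m (Nat.dist k i) + (m' (k + i) + m' (Nat.dist k i)) from by abel,
      map_add]
    rfl
  map_smul' c m := Finsupp.ext fun i => by
    simp only [Finsupp.onFinset_apply, Finsupp.smul_apply, RingHom.id_apply]
    rw [← smul_add, map_smul]
    rfl

theorem controlField_apply (k : ℕ) (l : Fin 3) (m : ℕ →₀ (Fin 3 → ℝ)) (i : ℕ) :
    controlField k l m i = crossProduct (m (k + i) + m (Nat.dist k i)) (stdBasis l) := rfl

/-- The shift operators multiply like cosines. -/
theorem shift_mul (m : ℕ → (Fin 3 → ℝ)) (p q i : ℕ) :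
    (m (p + (q + i)) + m (Nat.dist p (q + i))) +
      (m (p + Nat.dist q i) + m (Nat.dist p (Nat.dist q i)))
    = (m (Nat.dist p q + i) + m (Nat.dist (Nat.dist p q) i)) +
      (m (p + q + i) + m (Nat.dist (p + q) i)) := by
  have h0 : p + (q + i) = p + q + i := by omega
  rw [h0]
  rcases Nat.le_total p q with hpq | hpq <;> rcases Nat.le_total i q with hi | hi
  · have h1 : Nat.dist p (q + i) = Nat.dist p q + i := by unfold Nat.dist; omega
    have h2 : p + Nat.dist q i = Nat.dist (p + q) i := by unfold Nat.dist; omega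
    have h3 : Nat.dist p (Nat.dist q i) = Nat.dist (Nat.dist p q) i := by unfold Nat.dist; omega
    rw [h1, h2, h3]; abel
  · have h1 : Nat.dist p (q + i) = Nat.dist p q + i := by unfold Nat.dist; omega
    have h2 : p + Nat.dist q i = Nat.dist (Nat.dist p q) i := by unfold Nat.dist; omega
    have h3 : Nat.dist p (Nat.dist q i) = Nat.dist (p + q) i := by unfold Nat.dist; omega
    rw [h1, h2, h3]; abel
  · have h1 : Nat.dist p (q + i) = Nat.dist (Nat.dist p q) i := by unfold Nat.dist; omega
    have h2 : p + Nat.dist q i = Nat.dist (p + q) i := by unfold Nat.dist; omega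
    have h3 : Nat.dist p (Nat.dist q i) = Nat.dist p q + i := by unfold Nat.dist; omega
    rw [h1, h2, h3]; abel
  · have h1 : Nat.dist p (q + i) = Nat.dist (Nat.dist p q) i := by unfold Nat.dist; omega
    have h2 : p + Nat.dist q i = Nat.dist p q + i := by unfold Nat.dist; omega
    have h3 : Nat.dist p (Nat.dist q i) = Nat.dist (p + q) i := by unfold Nat.dist; omega
    rw [h1, h2, h3]; abel

theorem cross_jacobi (a : Fin 3 → ℝ) :
    crossProduct (crossProduct a (stdBasis 2)) (stdBasis 0)
      - crossProduct (crossProduct a (stdBasis 0)) (stdBasis 2)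
    = crossProduct a (stdBasis 1) := by
  ext j
  fin_cases j <;> simp [stdBasis, cross_apply]

/-- `[f^{p,3}, f^{q,1}] = f^{|p−q|,2} + f^{p+q,2}` for all `p q : ℕ`,
where `[A,B] = B∘A − A∘B`. -/
theorem bracket_fp3_fq1 (p q : ℕ) :
    controlField q 0 ∘ₗ controlField p 2 - controlField p 2 ∘ₗ controlField q 0
      = controlField (Nat.dist p q) 1 + controlField (p + q) 1 := by
  refine LinearMap.ext fun m => Finsupp.ext fun i => ?_
  simp only [LinearMap.comp_apply, LinearMap.sub_apply, LinearMap.add_apply, Finsupp.sub_apply,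
    Finsupp.add_apply, controlField_apply]
  have h1 := shift_mul m p q i
  have h2 := shift_mul m q p i
  rw [Nat.dist_comm q p, Nat.add_comm q p] at h2
  have hadd : ∀ (a b : Fin 3 → ℝ) (l : Fin 3),
      crossProduct a (stdBasis l) + crossProduct b (stdBasis l)
        = crossProduct (a + b) (stdBasis l) := by
    intro a b l
    rw [map_add, LinearMap.add_apply]
  rw [hadd, hadd, hadd, h1, h2]
  exact cross_jacobi _
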